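/- For every integer k ≥ 0, the function x ↦ (−1)^k Φ^{(k)}(x) is completely monotonic on (0,∞), and (−1)^k x^{k+1} Φ^{(k)}(x) tends to k! as x → 0⁺ and tends to k!/2 as x → ∞. -/

import Mathlib

open Filter

/-- A function `f` is completely monotonic on a set `s` if it has derivatives of all
orders on `s` and `(-1)^n f^(n) ≥ 0` on `s` for every `n ≥ 0`. -/
def CompletelyMonotonicOn (f : ℝ → ℝ) (s : Set ℝ) : Prop :=
  (∀ n : ℕ, ∀ x ∈ s, DifferentiableAt ℝ (iteratedDeriv n f) x) ∧
  ∀ n : ℕ, ∀ x ∈ s, 0 ≤ (-1:ℝ) ^ n * iteratedDeriv n f x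

/-- `Φ x = x * ψ'(x) - 1`, where `ψ'` is the trigamma function, i.e. the second
derivative of the logarithm of the gamma function. -/
noncomputable def Phi (x : ℝ) : ℝ :=
  x * iteratedDeriv 2 (fun y => Real.log (Real.Gamma y)) x - 1

open Set MeasureTheory ProbabilityTheory Topology

lemma sub_eq_sub_of_monotoneOn_of_add_one {f g : ℝ → ℝ}
    (hf : MonotoneOn f (Ioi 0)) (hg : MonotoneOn g (Ioi 0))
    (hf1 : ∀ x > 0, f (x + 1) = f x + 1 / x) (hg1 : ∀ x > 0, g (x + 1) = g x + 1 / x)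
    {x y : ℝ} (hx : 0 < x) (hy : 0 < y) : f x - g x = f y - g y := by
  wlog hxy : x ≤ y generalizing x y
  · exact (this hy hx (le_of_not_ge hxy)).symm
  have periodic : ∀ z > 0, ∀ N : ℕ, f (z + N) - g (z + N) = f z - g z := by
    intro z hz N
    induction N with
    | zero => simp
    | succ N ih =>
      have hzN : 0 < z + N := by positivity
      rw [← ih, Nat.cast_succ, ← add_assoc, hf1 _ hzN, hg1 _ hzN]
      ring
  have increment : ∀ h : ℝ → ℝ, (∀ x > 0, h (x + 1) = h x + 1 / x) →
      ∀ M : ℕ, ∀ z > 0, h (z + M) - h z ≤ M / z := by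
    intro h h1 M z hz
    induction M with
    | zero => simp
    | succ M ih =>
      have hzM : 0 < z + M := by positivity
      have hle : 1 / (z + M) ≤ 1 / z := by
        apply one_div_le_one_div_of_le hz
        linarith [Nat.cast_nonneg (α := ℝ) M]
      rw [Nat.cast_succ, ← add_assoc, h1 _ hzM, add_div]
      linarith
  obtain ⟨M, hM⟩ := exists_nat_ge (y - x)
  have bracket : ∀ h : ℝ → ℝ, MonotoneOn h (Ioi 0) → (∀ x > 0, h (x + 1) = h x + 1 / x) →
      ∀ N : ℕ, 0 ≤ h (y + N) - h (x + N) ∧ h (y + N) - h (x + N) ≤ M / (x + N) := by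
    intro h hm h1 N
    have hxN : 0 < x + N := by positivity
    have hyN : 0 < y + N := by positivity
    have hxNM : 0 < x + N + M := by positivity
    have lower := hm (mem_Ioi.2 hxN) (mem_Ioi.2 hyN) (by linarith)
    have upper := hm (mem_Ioi.2 hyN) (mem_Ioi.2 hxNM) (by linarith)
    have := increment h h1 M (x + N) hxN
    constructor <;> linarith
  have bound : ∀ N : ℕ, |(f x - g x) - (f y - g y)| ≤ M / (x + N) := by
    intro N
    rw [← periodic x hx N, ← periodic y hy N, abs_le]
    have h1 := bracket f hf hf1 N
    have h2 := bracket g hg hg1 N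
    constructor <;> linarith
  have lim : Tendsto (fun N : ℕ => (M : ℝ) / (x + N)) atTop (𝓝 0) :=
    tendsto_const_nhds.div_atTop (tendsto_atTop_add_const_left _ _ tendsto_natCast_atTop_atTop)
  have := ge_of_tendsto' lim bound
  linarith [abs_nonpos_iff.1 this]

lemma integrableOn_pow_mul_exp_neg_mul (n : ℕ) {x : ℝ} (hx : 0 < x) :
    IntegrableOn (fun t : ℝ => t ^ n * Real.exp (-(x * t))) (Ioi 0) := by
  have := integrableOn_rpow_mul_exp_neg_mul_rpow (p := 1) (s := n) (b := x)
    (by linarith [Nat.cast_nonneg (α := ℝ) n]) one_pos hx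
  simpa using this

lemma integral_exp_neg_mul_Ioi {x : ℝ} (hx : 0 < x) :
    ∫ t in Ioi (0 : ℝ), Real.exp (-(x * t)) = 1 / x := by
  have := Real.integral_rpow_mul_exp_neg_mul_Ioi one_pos hx
  simpa using this

/-- The Todd function `t / (1 - exp (-t))`. -/
noncomputable def todd (t : ℝ) : ℝ := t / (1 - Real.exp (-t))

/-- The derivative of the Todd function away from the origin. -/
noncomputable def toddDeriv (t : ℝ) : ℝ :=
  (1 - Real.exp (-t) - t * Real.exp (-t)) / (1 - Real.exp (-t)) ^ 2

lemma one_sub_exp_neg_pos {t : ℝ} (ht : 0 < t) : 0 < 1 - Real.exp (-t) := by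
  simpa using ht

lemma todd_nonneg {t : ℝ} (ht : 0 < t) : 0 ≤ todd t :=
  div_nonneg ht.le (one_sub_exp_neg_pos ht).le

lemma one_add_mul_exp_neg_le_one (t : ℝ) : (1 + t) * Real.exp (-t) ≤ 1 := by
  rw [Real.exp_neg, ← div_eq_mul_inv, div_le_one (Real.exp_pos t)]
  linarith [Real.add_one_le_exp t]

lemma todd_le {t : ℝ} (ht : 0 < t) : todd t ≤ 1 + t := by
  rw [todd, div_le_iff₀ (one_sub_exp_neg_pos ht)]
  linarith [one_add_mul_exp_neg_le_one t]

lemma toddDeriv_nonneg (t : ℝ) : 0 ≤ toddDeriv t :=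
  div_nonneg (by linarith [one_add_mul_exp_neg_le_one t]) (sq_nonneg _)

lemma toddDeriv_le_one {t : ℝ} (ht : 0 < t) : toddDeriv t ≤ 1 := by
  rw [toddDeriv, div_le_one (pow_pos (one_sub_exp_neg_pos ht) 2)]
  nlinarith [Real.add_one_le_exp (-t), Real.exp_pos (-t)]

lemma hasDerivAt_exp_neg (t : ℝ) : HasDerivAt (fun s => Real.exp (-s)) (-Real.exp (-t)) t := by
  simpa using (hasDerivAt_neg t).exp

lemma hasDerivAt_todd {t : ℝ} (ht : 0 < t) : HasDerivAt todd (toddDeriv t) t := by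
  have := (hasDerivAt_id t).div ((hasDerivAt_exp_neg t).const_sub 1) (one_sub_exp_neg_pos ht).ne'
  convert! this using 1
  simp [toddDeriv]

lemma measurable_todd : Measurable todd := by unfold todd; fun_prop

lemma measurable_toddDeriv : Measurable toddDeriv := by unfold toddDeriv; fun_prop

lemma tendsto_todd_zero : Tendsto todd (𝓝[>] 0) (𝓝 1) := by
  refine HasDerivAt.lhopital_zero_nhdsGT (f' := fun _ => 1) (g' := fun t => Real.exp (-t))
    (.of_forall fun t => hasDerivAt_id t)
    (.of_forall fun t => by simpa using (hasDerivAt_exp_neg t).const_sub 1)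
    (.of_forall fun t => (Real.exp_pos _).ne') ?_ ?_ ?_
  · exact tendsto_nhdsWithin_of_tendsto_nhds tendsto_id
  · exact tendsto_nhdsWithin_of_tendsto_nhds (Continuous.tendsto' (by fun_prop) _ _ (by simp))
  · refine tendsto_nhdsWithin_of_tendsto_nhds (Continuous.tendsto' ?_ _ _ (by simp))
    exact continuous_const.div (by fun_prop) fun t => (Real.exp_pos _).ne'

lemma tendsto_toddDeriv_zero : Tendsto toddDeriv (𝓝[>] 0) (𝓝 (1 / 2)) := by
  have numerator : Tendsto (fun t : ℝ => (1 - Real.exp (-t) - t * Real.exp (-t)) / t ^ 2)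
      (𝓝[>] 0) (𝓝 (1 / 2)) := by
    refine HasDerivAt.lhopital_zero_nhdsGT (f' := fun t => t * Real.exp (-t))
      (g' := fun t => 2 * t) (.of_forall fun t => ?_) (.of_forall fun t => ?_) ?_ ?_ ?_ ?_
    · convert! ((hasDerivAt_exp_neg t).const_sub 1).sub
        ((hasDerivAt_id t).mul (hasDerivAt_exp_neg t)) using 1
      simp
    · simpa using hasDerivAt_pow 2 t
    · filter_upwards [self_mem_nhdsWithin] with t ht
      exact (mul_pos two_pos ht).ne'
    · exact tendsto_nhdsWithin_of_tendsto_nhds (Continuous.tendsto' (by fun_prop) _ _ (by simp))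
    · exact tendsto_nhdsWithin_of_tendsto_nhds (Continuous.tendsto' (by fun_prop) _ _ (by simp))
    · have : Tendsto (fun t : ℝ => Real.exp (-t) / 2) (𝓝[>] 0) (𝓝 (1 / 2)) :=
        tendsto_nhdsWithin_of_tendsto_nhds (Continuous.tendsto' (by fun_prop) _ _ (by simp))
      refine this.congr' ?_
      filter_upwards [self_mem_nhdsWithin] with t ht
      have : t ≠ 0 := (mem_Ioi.1 ht).ne'
      field_simp
  have product := numerator.mul (tendsto_todd_zero.pow 2)
  simp only [one_pow, mul_one] at product
  refine product.congr' ?_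
  filter_upwards [self_mem_nhdsWithin] with t ht
  have h0 : t ≠ 0 := (mem_Ioi.1 ht).ne'
  have h1 := (one_sub_exp_neg_pos (mem_Ioi.1 ht)).ne'
  rw [todd, toddDeriv]
  field_simp

lemma tendsto_toddDeriv_atTop : Tendsto toddDeriv atTop (𝓝 1) := by
  have h0 : Tendsto (fun t : ℝ => Real.exp (-t)) atTop (𝓝 0) :=
    Real.tendsto_exp_neg_atTop_nhds_zero
  have h1 : Tendsto (fun t : ℝ => t * Real.exp (-t)) atTop (𝓝 0) := by
    simpa using Real.tendsto_pow_mul_exp_neg_atTop_nhds_zero 1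
  have := ((h0.const_sub 1).sub h1).div ((h0.const_sub 1).pow 2) (by norm_num)
  simpa [toddDeriv] using! this

lemma integrableOn_todd_mul_exp {x : ℝ} (hx : 0 < x) :
    IntegrableOn (fun t => todd t * Real.exp (-(x * t))) (Ioi 0) := by
  have bound := (integrableOn_pow_mul_exp_neg_mul 0 hx).add (integrableOn_pow_mul_exp_neg_mul 1 hx)
  refine bound.mono' (measurable_todd.mul (by fun_prop)).aestronglyMeasurable ?_
  filter_upwards [ae_restrict_mem measurableSet_Ioi] with t ht
  rw [Real.norm_of_nonneg (mul_nonneg (todd_nonneg ht) (Real.exp_pos _).le)]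
  simp only [Pi.add_apply, pow_zero, pow_one, ← add_mul]
  exact mul_le_mul_of_nonneg_right (todd_le ht) (Real.exp_pos _).le

lemma integrableOn_toddDeriv_mul_pow_mul_exp (n : ℕ) {x : ℝ} (hx : 0 < x) :
    IntegrableOn (fun t => toddDeriv t * (t ^ n * Real.exp (-(x * t)))) (Ioi 0) := by
  refine (integrableOn_pow_mul_exp_neg_mul n hx).mono'
    (measurable_toddDeriv.mul (by fun_prop)).aestronglyMeasurable ?_
  filter_upwards [ae_restrict_mem measurableSet_Ioi] with t ht
  have : 0 ≤ t ^ n * Real.exp (-(x * t)) :=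
    mul_nonneg (pow_nonneg (mem_Ioi.1 ht).le n) (Real.exp_pos _).le
  rw [Real.norm_of_nonneg (mul_nonneg (toddDeriv_nonneg t) this)]
  exact mul_le_of_le_one_left this (toddDeriv_le_one ht)

/-- Gauss's integral for the digamma function, up to an additive constant. -/
noncomputable def gaussIntegral (x : ℝ) : ℝ :=
  ∫ t in Ioi (0 : ℝ), (Real.exp (-t) - Real.exp (-(x * t))) / (1 - Real.exp (-t))

lemma abs_exp_sub_exp_le (a b : ℝ) :
    |Real.exp a - Real.exp b| ≤ |a - b| * (Real.exp a + Real.exp b) := by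
  wlog h : b ≤ a generalizing a b
  · rw [abs_sub_comm, abs_sub_comm a b, add_comm (Real.exp a)]
    exact this b a (le_of_not_ge h)
  rw [abs_of_nonneg (sub_nonneg.2 (Real.exp_le_exp.2 h)), abs_of_nonneg (sub_nonneg.2 h)]
  have : Real.exp b = Real.exp a * Real.exp (b - a) := by rw [← Real.exp_add]; ring_nf
  nlinarith [Real.add_one_le_exp (b - a), Real.exp_pos a, Real.exp_pos b,
    mul_nonneg (sub_nonneg.2 h) (Real.exp_pos b).le]

lemma aestronglyMeasurable_gaussIntegrand (x : ℝ) :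
    AEStronglyMeasurable (fun t => (Real.exp (-t) - Real.exp (-(x * t))) / (1 - Real.exp (-t)))
      (volume.restrict (Ioi 0)) :=
  Measurable.aestronglyMeasurable (by fun_prop)

lemma integrableOn_gaussIntegrand {x : ℝ} (hx : 0 < x) :
    IntegrableOn (fun t => (Real.exp (-t) - Real.exp (-(x * t))) / (1 - Real.exp (-t)))
      (Ioi 0) := by
  have bound := ((integrableOn_todd_mul_exp one_pos).add (integrableOn_todd_mul_exp hx)).const_mul
    |x - 1|
  refine bound.mono' (aestronglyMeasurable_gaussIntegrand x) ?_
  filter_upwards [ae_restrict_mem measurableSet_Ioi] with t ht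
  have hpos := one_sub_exp_neg_pos (mem_Ioi.1 ht)
  have key := abs_exp_sub_exp_le (-t) (-(x * t))
  rw [show -t - -(x * t) = (x - 1) * t by ring, abs_mul, abs_of_pos (mem_Ioi.1 ht)] at key
  rw [Real.norm_eq_abs, abs_div, abs_of_pos hpos, div_le_iff₀ hpos]
  simp only [Pi.add_apply, todd, one_mul]
  refine key.trans_eq ?_
  field_simp

lemma monotoneOn_gaussIntegral : MonotoneOn gaussIntegral (Ioi 0) := by
  intro x hx y hy hxy
  refine setIntegral_mono_on (integrableOn_gaussIntegrand hx) (integrableOn_gaussIntegrand hy)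
    measurableSet_Ioi fun t ht => ?_
  have hpos := one_sub_exp_neg_pos (mem_Ioi.1 ht)
  have : x * t ≤ y * t := mul_le_mul_of_nonneg_right hxy (mem_Ioi.1 ht).le
  gcongr

lemma gaussIntegral_add_one {x : ℝ} (hx : 0 < x) :
    gaussIntegral (x + 1) = gaussIntegral x + 1 / x := by
  rw [← sub_eq_iff_eq_add', gaussIntegral, gaussIntegral,
    ← integral_sub (integrableOn_gaussIntegrand (by linarith)) (integrableOn_gaussIntegrand hx),
    ← integral_exp_neg_mul_Ioi hx]
  refine setIntegral_congr_fun measurableSet_Ioi fun t ht => ?_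
  have hpos := (one_sub_exp_neg_pos (mem_Ioi.1 ht)).ne'
  have : Real.exp (-((x + 1) * t)) = Real.exp (-(x * t)) * Real.exp (-t) := by
    rw [← Real.exp_add]; ring_nf
  simp only [this]
  field_simp
  ring

lemma hasDerivAt_gaussIntegral {x : ℝ} (hx : 0 < x) :
    HasDerivAt gaussIntegral (∫ t in Ioi (0 : ℝ), todd t * Real.exp (-(x * t))) x := by
  refine (hasDerivAt_integral_of_dominated_loc_of_deriv_le (s := Ioi (x / 2))
    (bound := fun t => todd t * Real.exp (-(x / 2 * t)))
    (F' := fun x t => todd t * Real.exp (-(x * t)))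
    (Ioi_mem_nhds (by linarith)) (.of_forall aestronglyMeasurable_gaussIntegrand)
    (integrableOn_gaussIntegrand hx) (measurable_todd.mul (by fun_prop)).aestronglyMeasurable
    ?_ (integrableOn_todd_mul_exp (by linarith)) ?_).2
  · filter_upwards [ae_restrict_mem measurableSet_Ioi] with t ht y hy
    rw [Real.norm_of_nonneg (mul_nonneg (todd_nonneg ht) (Real.exp_pos _).le)]
    have : x / 2 * t ≤ y * t := mul_le_mul_of_nonneg_right (mem_Ioi.1 hy).le (mem_Ioi.1 ht).le
    exact mul_le_mul_of_nonneg_left (Real.exp_le_exp.2 (by linarith)) (todd_nonneg ht)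
  · filter_upwards [ae_restrict_mem measurableSet_Ioi] with t ht y hy
    have := ((((hasDerivAt_id y).mul_const t).fun_neg.exp).const_sub (Real.exp (-t))).div_const
      (1 - Real.exp (-t))
    convert! this using 1
    simp only [id, todd]
    ring

lemma differentiableAt_log_Gamma {x : ℝ} (hx : 0 < x) :
    DifferentiableAt ℝ (fun y => Real.log (Real.Gamma y)) x :=
  (Real.differentiableAt_Gamma fun m => by linarith [Nat.cast_nonneg (α := ℝ) m]).log
    (Real.Gamma_pos_of_pos hx).ne'

lemma deriv_log_Gamma_add_one {x : ℝ} (hx : 0 < x) :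
    deriv (fun y => Real.log (Real.Gamma y)) (x + 1) =
      deriv (fun y => Real.log (Real.Gamma y)) x + 1 / x := by
  rw [← deriv_comp_add_const]
  have : (fun y => Real.log (Real.Gamma (y + 1))) =ᶠ[𝓝 x]
      fun y => Real.log (Real.Gamma y) + Real.log y := by
    filter_upwards [Ioi_mem_nhds hx] with y hy
    rw [Real.Gamma_add_one (mem_Ioi.1 hy).ne', Real.log_mul (mem_Ioi.1 hy).ne'
      (Real.Gamma_pos_of_pos hy).ne', add_comm]
  rw [this.deriv_eq, deriv_fun_add (differentiableAt_log_Gamma hx)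
    (Real.differentiableAt_log hx.ne'), Real.deriv_log, one_div]

lemma iteratedDeriv_two_log_Gamma {x : ℝ} (hx : 0 < x) :
    iteratedDeriv 2 (fun y => Real.log (Real.Gamma y)) x =
      ∫ t in Ioi (0 : ℝ), todd t * Real.exp (-(x * t)) := by
  have hmono : MonotoneOn (deriv fun y => Real.log (Real.Gamma y)) (Ioi 0) :=
    Real.convexOn_log_Gamma.monotoneOn_deriv fun y hy => differentiableAt_log_Gamma hy
  have heq : deriv (fun y => Real.log (Real.Gamma y)) =ᶠ[𝓝 x] fun y => gaussIntegral y +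
      (deriv (fun y => Real.log (Real.Gamma y)) 1 - gaussIntegral 1) := by
    filter_upwards [Ioi_mem_nhds hx] with y hy
    have := sub_eq_sub_of_monotoneOn_of_add_one hmono monotoneOn_gaussIntegral
      (fun x hx => deriv_log_Gamma_add_one hx) (fun x hx => gaussIntegral_add_one hx) hy one_pos
    linarith
  rw [iteratedDeriv_succ, iteratedDeriv_one, heq.deriv_eq]
  exact ((hasDerivAt_gaussIntegral hx).add_const _).deriv

lemma Phi_eq_integral {x : ℝ} (hx : 0 < x) :
    Phi x = ∫ t in Ioi (0 : ℝ), toddDeriv t * Real.exp (-(x * t)) := by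
  have hexp (t : ℝ) : HasDerivAt (fun t => -Real.exp (-(x * t))) (x * Real.exp (-(x * t))) t := by
    convert! (((hasDerivAt_id t).const_mul x).fun_neg.exp).neg using 1
    simp only [id]
    ring
  have hint : IntegrableOn (fun t => toddDeriv t * Real.exp (-(x * t))) (Ioi 0) := by
    simpa using integrableOn_toddDeriv_mul_pow_mul_exp 0 hx
  have hzero : Tendsto (fun t => -Real.exp (-(x * t))) (𝓝[>] 0) (𝓝 (-1)) :=
    tendsto_nhdsWithin_of_tendsto_nhds (Continuous.tendsto' (by fun_prop) _ _ (by simp))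
  have htop : Tendsto (fun t => todd t * -Real.exp (-(x * t))) atTop (𝓝 0) := by
    have h1 : Tendsto (fun t : ℝ => Real.exp (-x * t)) atTop (𝓝 0) := by
      simpa using tendsto_rpow_mul_exp_neg_mul_atTop_nhds_zero 0 x hx
    have h2 : Tendsto (fun t : ℝ => t * Real.exp (-x * t)) atTop (𝓝 0) := by
      simpa using tendsto_rpow_mul_exp_neg_mul_atTop_nhds_zero 1 x hx
    have h3 := (h1.add h2).neg
    rw [add_zero, neg_zero] at h3
    refine tendsto_of_tendsto_of_tendsto_of_le_of_le' h3 tendsto_const_nhds ?_ ?_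
    · filter_upwards [eventually_gt_atTop 0] with t ht
      rw [neg_mul]
      nlinarith [todd_le ht, Real.exp_pos (-(x * t))]
    · filter_upwards [eventually_gt_atTop 0] with t ht
      nlinarith [todd_nonneg ht, Real.exp_pos (-(x * t))]
  have parts := integral_Ioi_mul_deriv_eq_deriv_mul (a := 0) (u := todd) (u' := toddDeriv)
    (v := fun t => -Real.exp (-(x * t))) (v' := fun t => x * Real.exp (-(x * t)))
    (fun t ht => hasDerivAt_todd ht) (fun t _ => hexp t)
    (IntegrableOn.congr_fun ((integrableOn_todd_mul_exp hx).const_mul x)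
      (fun t _ => by simp only [Pi.mul_apply]; ring) measurableSet_Ioi)
    (IntegrableOn.congr_fun hint.neg (fun t _ => by simp) measurableSet_Ioi)
    (tendsto_todd_zero.mul hzero) htop
  simp only [mul_neg, integral_neg, mul_left_comm _ x, integral_const_mul] at parts
  rw [Phi, iteratedDeriv_two_log_Gamma hx, parts]
  ring

/-- The measure on `(0, ∞)` whose Laplace transform is `Phi`. -/
noncomputable def toddMeasure : Measure ℝ :=
  (volume.restrict (Ioi 0)).withDensity fun t => ENNReal.ofReal (toddDeriv t)

lemma integral_toddMeasure (f : ℝ → ℝ) :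
    ∫ t, f t ∂toddMeasure = ∫ t in Ioi (0 : ℝ), toddDeriv t * f t := by
  rw [toddMeasure, integral_withDensity_eq_integral_toReal_smul
    measurable_toddDeriv.ennreal_ofReal (by simp)]
  simp [ENNReal.toReal_ofReal (toddDeriv_nonneg _)]

lemma mem_interior_integrableExpSet_toddMeasure {x : ℝ} (hx : 0 < x) :
    x ∈ interior (integrableExpSet (fun t => -t) toddMeasure) := by
  refine mem_interior.2 ⟨Ioi 0, fun y hy => ?_, isOpen_Ioi, hx⟩
  have := integrableOn_toddDeriv_mul_pow_mul_exp 0 (mem_Ioi.1 hy)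
  rw [integrableExpSet, mem_ofPred_eq, toddMeasure, integrable_withDensity_iff
    measurable_toddDeriv.ennreal_ofReal (by simp)]
  simpa [IntegrableOn, ENNReal.toReal_ofReal (toddDeriv_nonneg _), mul_comm] using this

lemma Phi_eventuallyEq_mgf {x : ℝ} (hx : 0 < x) :
    Phi =ᶠ[𝓝 x] mgf (fun t => -t) toddMeasure := by
  filter_upwards [Ioi_mem_nhds hx] with y hy
  rw [Phi_eq_integral hy, mgf, integral_toddMeasure]
  simp

lemma neg_one_pow_mul_iteratedDeriv_Phi (n : ℕ) {x : ℝ} (hx : 0 < x) :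
    (-1) ^ n * iteratedDeriv n Phi x =
      ∫ t in Ioi (0 : ℝ), toddDeriv t * (t ^ n * Real.exp (-(x * t))) := by
  rw [(Phi_eventuallyEq_mgf hx).iteratedDeriv_eq,
    iteratedDeriv_mgf (mem_interior_integrableExpSet_toddMeasure hx), integral_toddMeasure,
    ← integral_const_mul]
  refine integral_congr_ae (.of_forall fun t => ?_)
  have : (-1 : ℝ) ^ n * (-1) ^ n = 1 := by rw [← mul_pow]; simp
  simp only [neg_pow t, mul_neg]
  linear_combination toddDeriv t * t ^ n * Real.exp (-(x * t)) * this

lemma differentiableAt_iteratedDeriv_Phi (n : ℕ) {x : ℝ} (hx : 0 < x) :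
    DifferentiableAt ℝ (iteratedDeriv n Phi) x := by
  have heq : iteratedDeriv n Phi =ᶠ[𝓝 x] iteratedDeriv n (mgf (fun t => -t) toddMeasure) := by
    filter_upwards [Ioi_mem_nhds hx] with y hy
    exact (Phi_eventuallyEq_mgf hy).iteratedDeriv_eq n
  exact heq.differentiableAt_iff.2
    (differentiableAt_iteratedDeriv_mgf (mem_interior_integrableExpSet_toddMeasure hx) n)

lemma pow_mul_iteratedDeriv_Phi (k : ℕ) {x : ℝ} (hx : 0 < x) :
    (-1) ^ k * x ^ (k + 1) * iteratedDeriv k Phi x =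
      ∫ u in Ioi (0 : ℝ), toddDeriv (x⁻¹ * u) * (u ^ k * Real.exp (-u)) := by
  have subst := integral_comp_mul_left_Ioi
    (fun u => toddDeriv (x⁻¹ * u) * (u ^ k * Real.exp (-u))) 0 hx
  rw [mul_zero, smul_eq_mul, eq_inv_mul_iff_mul_eq₀ hx.ne'] at subst
  rw [← subst, mul_right_comm, neg_one_pow_mul_iteratedDeriv_Phi k hx, mul_comm,
    ← integral_const_mul, ← integral_const_mul]
  refine integral_congr_ae (.of_forall fun t => ?_)
  simp only [inv_mul_cancel_left₀ hx.ne']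
  ring

lemma tendsto_pow_mul_iteratedDeriv_Phi (k : ℕ) {l : Filter ℝ} [l.IsCountablyGenerated]
    (hl : ∀ᶠ x in l, 0 < x) {c : ℝ}
    (hc : ∀ u > 0, Tendsto (fun x => toddDeriv (x⁻¹ * u)) l (𝓝 c)) :
    Tendsto (fun x : ℝ => (-1) ^ k * x ^ (k + 1) * iteratedDeriv k Phi x) l
      (𝓝 (c * k.factorial)) := by
  have hint : ∫ u in Ioi (0 : ℝ), u ^ k * Real.exp (-u) = k.factorial := by
    rw [← Real.Gamma_nat_eq_factorial, Real.Gamma_eq_integral (by positivity)]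
    simp [mul_comm]
  have hbound : IntegrableOn (fun u : ℝ => u ^ k * Real.exp (-u)) (Ioi 0) := by
    simpa using integrableOn_pow_mul_exp_neg_mul k one_pos
  rw [← hint, ← integral_const_mul]
  have hlim : Tendsto
      (fun x : ℝ => ∫ u in Ioi (0 : ℝ), toddDeriv (x⁻¹ * u) * (u ^ k * Real.exp (-u))) l
      (𝓝 (∫ u in Ioi (0 : ℝ), c * (u ^ k * Real.exp (-u)))) := by
    refine tendsto_integral_filter_of_dominated_convergence
      (fun u : ℝ => u ^ k * Real.exp (-u)) (.of_forall fun x => ?_) ?_ hbound ?_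
    · exact ((measurable_toddDeriv.comp (by fun_prop)).mul (by fun_prop)).aestronglyMeasurable
    · filter_upwards [hl] with x hx
      filter_upwards [ae_restrict_mem measurableSet_Ioi] with u hu
      have : 0 ≤ u ^ k * Real.exp (-u) :=
        mul_nonneg (pow_nonneg (mem_Ioi.1 hu).le k) (Real.exp_pos _).le
      rw [Real.norm_of_nonneg (mul_nonneg (toddDeriv_nonneg _) this)]
      exact mul_le_of_le_one_left this (toddDeriv_le_one (mul_pos (inv_pos.2 hx) hu))
    · filter_upwards [ae_restrict_mem measurableSet_Ioi] with u hu
      exact (hc u hu).mul_const _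
  refine hlim.congr' ?_
  filter_upwards [hl] with x hx
  exact (pow_mul_iteratedDeriv_Phi k hx).symm

lemma iteratedDeriv_iteratedDeriv_Phi (n k : ℕ) (x : ℝ) :
    iteratedDeriv n (fun x => (-1 : ℝ) ^ k * iteratedDeriv k Phi x) x =
      (-1) ^ k * iteratedDeriv (n + k) Phi x := by
  rw [iteratedDeriv_const_mul_field]
  simp only [iteratedDeriv_eq_iterate, Function.iterate_add_apply]

theorem Phi_deriv_completelyMonotonic_and_limits (k : ℕ) :
    CompletelyMonotonicOn (fun x => (-1:ℝ) ^ k * iteratedDeriv k Phi x) (Set.Ioi 0) ∧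
    Tendsto (fun x : ℝ => (-1:ℝ) ^ k * x ^ (k + 1) * iteratedDeriv k Phi x)
      (nhdsWithin 0 (Set.Ioi 0)) (nhds (Nat.factorial k : ℝ)) ∧
    Tendsto (fun x : ℝ => (-1:ℝ) ^ k * x ^ (k + 1) * iteratedDeriv k Phi x)
      atTop (nhds ((Nat.factorial k : ℝ) / 2)) := by
  refine ⟨⟨fun n x hx => ?_, fun n x hx => ?_⟩, ?_, ?_⟩
  · rw [funext (iteratedDeriv_iteratedDeriv_Phi n k)]
    exact (differentiableAt_iteratedDeriv_Phi (n + k) hx).const_mul _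
  · rw [iteratedDeriv_iteratedDeriv_Phi, ← mul_assoc, ← pow_add,
      neg_one_pow_mul_iteratedDeriv_Phi _ hx]
    exact setIntegral_nonneg measurableSet_Ioi fun t ht => mul_nonneg (toddDeriv_nonneg t)
      (mul_nonneg (pow_nonneg (mem_Ioi.1 ht).le _) (Real.exp_pos _).le)
  · have := tendsto_pow_mul_iteratedDeriv_Phi k (l := 𝓝[>] 0) self_mem_nhdsWithin fun u hu =>
      tendsto_toddDeriv_atTop.comp (tendsto_inv_nhdsGT_zero.atTop_mul_const hu)
    rwa [one_mul] at this
  · have := tendsto_pow_mul_iteratedDeriv_Phi k (eventually_gt_atTop 0) fun u hu =>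
      tendsto_toddDeriv_zero.comp (tendsto_nhdsWithin_iff.2
        ⟨by simpa using tendsto_inv_atTop_zero.mul_const u, by
          filter_upwards [eventually_gt_atTop 0] with x hx
          exact mul_pos (inv_pos.2 hx) hu⟩)
    rwa [one_div_mul_eq_div] at this
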